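/- Let U ⊂ ℝ^{d−1} be a bounded open set, L > 0, w : ℝ^{d−1} × ℝ → ℝ a C^∞ function, and k ≥ 1 an integer. For a C^∞ function τ : ℝ^{d−1} → ℝ with τ > 0, let C(τ) denote the constant term in the small-ε asymptotic expansion F_τ(ε) = Σ_{ℓ=1}^{k−1} c_ℓ(τ) ε^{−ℓ} + A log ε + C(τ) + o(1) of the regulated volume F_τ(ε) = ∫_U ∫_{ε τ(x)}^{L} w(x,y) y^{−k} dy dx (this expansion exists and its coefficients are uniquely determined). Then for every C^∞ function ω : ℝ^{d−1} → ℝ, C(e^{ω} τ) − C(τ) = −(1/(k−1)!) ∫_U ω(x) ∂_y^{k−1} w(x,0) dx. -/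

import Mathlib

open MeasureTheory Filter Topology Set

theorem constant_eq_zero_of_tendsto_zero (n : ℕ) (e : ℕ → ℝ) (B D : ℝ)
    (h : Tendsto (fun ε : ℝ => (∑ ℓ ∈ Finset.Icc 1 n, e ℓ / ε ^ ℓ) + B * Real.log ε + D)
      (𝓝[>] (0 : ℝ)) (𝓝 0)) : D = 0 := by
  have hid : Tendsto (fun ε : ℝ => ε) (𝓝[>] (0 : ℝ)) (𝓝 0) := nhdsWithin_le_nhds
  have hpos : ∀ᶠ ε : ℝ in 𝓝[>] (0 : ℝ), 0 < ε := eventually_mem_nhdsWithin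
  induction n with
  | zero =>
    have hlog : Tendsto (fun ε : ℝ => (Real.log ε)⁻¹) (𝓝[>] (0 : ℝ)) (𝓝 0) :=
      tendsto_inv_atBot_zero.comp Real.tendsto_log_nhdsGT_zero
    have hne : ∀ᶠ ε : ℝ in 𝓝[>] (0 : ℝ), Real.log ε < 0 :=
      Real.tendsto_log_nhdsGT_zero.eventually (eventually_lt_atBot 0)
    have hB : B = 0 := by
      have h1 := (h.mul hlog).sub (hlog.const_mul D)
      refine tendsto_nhds_unique (tendsto_const_nhds.congr' ?_) (h1.trans_eq ?_)
      · filter_upwards [hne] with ε hε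
        have := hε.ne
        simp only [zero_lt_one, Finset.Icc_eq_empty_of_lt, Finset.sum_empty]
        field_simp
        ring
      · simp
    subst hB
    simpa using h
  | succ n ih =>
    apply ih
    have hlog : Tendsto (fun ε : ℝ => Real.log ε * ε ^ (n + 1)) (𝓝[>] (0 : ℝ)) (𝓝 0) := by
      have := tendsto_log_mul_rpow_nhdsGT_zero (r := ((n + 1 : ℕ) : ℝ)) (by positivity)
      simpa only [Real.rpow_natCast] using this
    have hpow : ∀ m : ℕ, 0 < m → Tendsto (fun ε : ℝ => ε ^ m) (𝓝[>] (0 : ℝ)) (𝓝 0) := by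
      intro m hm
      simpa [hm.ne'] using hid.pow m
    have hsum : Tendsto (fun ε : ℝ => ∑ ℓ ∈ Finset.Icc 1 n, e ℓ * ε ^ (n + 1 - ℓ))
        (𝓝[>] (0 : ℝ)) (𝓝 0) := by
      rw [← Finset.sum_const_zero (s := Finset.Icc 1 n)]
      refine tendsto_finsetSum _ fun ℓ hℓ => ?_
      have := (Finset.mem_Icc.1 hℓ).2
      simpa using (hpow (n + 1 - ℓ) (by omega)).const_mul (e ℓ)
    have he : e (n + 1) = 0 := by
      have h1 := (((h.mul (hpow (n + 1) n.succ_pos)).sub hsum).sub (hlog.const_mul B)).sub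
        ((hpow (n + 1) n.succ_pos).const_mul D)
      refine tendsto_nhds_unique (tendsto_const_nhds.congr' ?_) (h1.trans_eq (by simp))
      filter_upwards [hpos] with ε hε
      have h2 : ∑ ℓ ∈ Finset.Icc 1 n, e ℓ * ε ^ (n + 1 - ℓ)
          = (∑ ℓ ∈ Finset.Icc 1 n, e ℓ / ε ^ ℓ) * ε ^ (n + 1) := by
        rw [Finset.sum_mul]
        refine Finset.sum_congr rfl fun ℓ hℓ => ?_
        have := (Finset.mem_Icc.1 hℓ).2
        rw [pow_sub₀ _ hε.ne' (by omega)]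
        ring
      rw [h2, Finset.sum_Icc_succ_top (by omega)]
      field_simp
      ring
    simpa [Finset.sum_Icc_succ_top, he] using h

section

variable {E : Type*} [NormedAddCommGroup E] [NormedSpace ℝ E]

theorem contDiff_iteratedDeriv_snd {w : E × ℝ → ℝ} (hw : ContDiff ℝ (⊤ : ℕ∞) w) (n : ℕ) :
    ContDiff ℝ (⊤ : ℕ∞) fun p : E × ℝ => iteratedDeriv n (fun y => w (p.1, y)) p.2 := by
  induction n with
  | zero => simpa using hw
  | succ n ih =>
    have hd : ∀ p : E × ℝ, iteratedDeriv (n + 1) (fun y => w (p.1, y)) p.2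
        = fderiv ℝ (fun p : E × ℝ => iteratedDeriv n (fun y => w (p.1, y)) p.2) p (0, 1) := by
      intro p
      rw [iteratedDeriv_succ]
      have h1 : HasDerivAt (fun y : ℝ => (p.1, y)) ((0 : E), (1 : ℝ)) p.2 :=
        (hasDerivAt_const _ _).prodMk (hasDerivAt_id _)
      have h2 := (ih.differentiable (by simp) (p.1, p.2)).hasFDerivAt
      exact (h2.comp_hasDerivAt p.2 h1).deriv
    simp_rw [hd]
    exact (ih.fderiv_right (by simp)).clm_apply contDiff_const

theorem exists_taylor_snd_bound [ProperSpace E] {w : E × ℝ → ℝ} (hw : ContDiff ℝ (⊤ : ℕ∞) w)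
    {U : Set E} (hU : Bornology.IsBounded U) (n : ℕ) :
    ∃ M, 0 ≤ M ∧ ∀ x ∈ U, ∀ y ∈ Icc (0 : ℝ) 1,
      |w (x, y) - ∑ j ∈ Finset.range (n + 1),
        iteratedDeriv j (fun y => w (x, y)) 0 / (j.factorial : ℝ) * y ^ j| ≤ M * y ^ (n + 1) := by
  obtain ⟨M, hM⟩ := (hU.isCompact_closure.prod (isCompact_Icc (a := (0 : ℝ)) (b := 1))
    ).exists_bound_of_continuousOn (contDiff_iteratedDeriv_snd hw (n + 1)).continuous.continuousOn
  refine ⟨|M| / n.factorial, by positivity, fun x hx y hy => ?_⟩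
  have hs : ContDiff ℝ (⊤ : ℕ∞) fun y : ℝ => w (x, y) := hw.comp (by fun_prop)
  have hd : ∀ j : ℕ, ∀ z ∈ Icc (0 : ℝ) 1, iteratedDerivWithin j (fun y => w (x, y)) (Icc 0 1) z
      = iteratedDeriv j (fun y => w (x, y)) z := fun j z hz =>
    iteratedDerivWithin_eq_iteratedDeriv (uniqueDiffOn_Icc zero_lt_one)
      (hs.of_le (by exact_mod_cast le_top)).contDiffAt hz
  have h := taylor_mean_remainder_bound (f := fun y => w (x, y)) (C := |M|) (n := n) zero_le_one
    (hs.of_le (by exact_mod_cast le_top)).contDiffOn hy fun z hz => by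
      rw [hd _ z hz]
      exact (hM (x, z) ⟨subset_closure hx, hz⟩).trans (le_abs_self M)
  rw [taylor_within_apply, Real.norm_eq_abs] at h
  convert h using 2
  · congr 1
    refine Finset.sum_congr rfl fun j _ => ?_
    rw [hd j 0 (by simp), smul_eq_mul, sub_zero]
    ring
  · rw [sub_zero]
    ring

theorem continuous_integral_div_pow {X : Type*} [TopologicalSpace X] [FirstCountableTopology X]
    {w : X × ℝ → ℝ} (hw : Continuous w) {a : X → ℝ} (ha : Continuous a) (hpos : ∀ x, 0 < a x)
    {L : ℝ} (hL : 0 < L) (k : ℕ) :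
    Continuous fun x => ∫ y in (a x)..L, w (x, y) / y ^ k := by
  have hm : ∀ x (y : ℝ), 0 < max y (min (a x) L) := fun x y =>
    lt_max_of_lt_right (lt_min (hpos x) hL)
  have hc : Continuous fun x => ∫ y in L..(a x), w (x, y) / (max y (min (a x) L)) ^ k := by
    apply intervalIntegral.continuous_parametric_intervalIntegral_of_continuous _ ha
    apply Continuous.div
    · exact hw
    · fun_prop
    · exact fun p => (pow_pos (hm _ _) k).ne'
  refine hc.neg.congr fun x => ?_
  rw [Pi.neg_apply, ← intervalIntegral.integral_symm]
  refine intervalIntegral.integral_congr fun y hy => ?_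
  simp only [max_eq_left (show min (a x) L ≤ y from hy.1)]

theorem intervalIntegrable_div_pow {f : ℝ → ℝ} (hf : Continuous f) {a b : ℝ} (ha : 0 < a)
    (hb : 0 < b) (k : ℕ) : IntervalIntegrable (fun y => f y / y ^ k) volume a b := by
  refine (hf.continuousOn.div (by fun_prop) fun y hy => ?_).intervalIntegrable
  exact (pow_pos ((lt_min ha hb).trans_le hy.1) k).ne'

theorem integral_div_pow_sub {f : ℝ → ℝ} (hf : Continuous f) {a b L : ℝ} (ha : 0 < a)
    (hb : 0 < b) (hL : 0 < L) (k : ℕ) :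
    (∫ y in a..L, f y / y ^ k) - (∫ y in b..L, f y / y ^ k) = ∫ y in a..b, f y / y ^ k := by
  rw [sub_eq_iff_eq_add, intervalIntegral.integral_add_adjacent_intervals] <;>
    exact intervalIntegrable_div_pow hf (by assumption) (by assumption) k

theorem integral_pow_div_pow_smul (j n : ℕ) {ε : ℝ} (hε : 0 < ε) (a b : ℝ) :
    ∫ y in (ε * a)..(ε * b), y ^ j / y ^ (n + 1)
      = ε ^ j / ε ^ n * ∫ y in a..b, y ^ j / y ^ (n + 1) := by
  have h := intervalIntegral.mul_integral_comp_mul_left (a := a) (b := b)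
    (f := fun y : ℝ => y ^ j / y ^ (n + 1)) ε
  rw [← h, ← intervalIntegral.integral_const_mul, ← intervalIntegral.integral_const_mul]
  refine intervalIntegral.integral_congr fun y _ => ?_
  simp only [mul_pow]
  field_simp
  ring

theorem Continuous.integrableOn_of_isBounded {E : Type*} [NormedAddCommGroup E] [ProperSpace E]
    [MeasurableSpace E] [BorelSpace E] {μ : Measure E} [IsFiniteMeasureOnCompacts μ] {f : E → ℝ} (hf : Continuous f) {U : Set E}
    (hU : Bornology.IsBounded U) : IntegrableOn f U μ :=
  (hf.continuousOn.integrableOn_compact hU.isCompact_closure).mono_set subset_closure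

theorem tendsto_integral_shell_sub_sum [ProperSpace E] [MeasurableSpace E] [BorelSpace E]
    {μ : Measure E} [IsFiniteMeasureOnCompacts μ] {w : E × ℝ → ℝ} (hw : ContDiff ℝ (⊤ : ℕ∞) w)
    {U : Set E} (hU : Bornology.IsBounded U) {τ σ : E → ℝ}
    (hτ : Continuous τ) (hσ : Continuous σ) (hτpos : ∀ x, 0 < τ x) (hσpos : ∀ x, 0 < σ x)
    (n : ℕ) :
    Tendsto (fun ε : ℝ =>
      (∫ x in U, (∫ y in (ε * τ x)..(ε * σ x), w (x, y) / y ^ (n + 1)) ∂μ)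
      - ∑ j ∈ Finset.range (n + 1), (∫ x in U, iteratedDeriv j (fun y => w (x, y)) 0
          / (j.factorial : ℝ) * (∫ y in (τ x)..(σ x), y ^ j / y ^ (n + 1)) ∂μ) * (ε ^ j / ε ^ n))
      (𝓝[>] (0 : ℝ)) (𝓝 0) := by
  obtain ⟨M, hM0, hM⟩ := exists_taylor_snd_bound hw hU n
  obtain ⟨S, hS⟩ := hU.isCompact_closure.exists_bound_of_continuousOn hσ.continuousOn
  obtain ⟨T, hT⟩ := hU.isCompact_closure.exists_bound_of_continuousOn hτ.continuousOn
  set R : ℝ := |S| + |T| + 1 with hR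
  have hR0 : 0 < R := by positivity
  have hσR : ∀ x ∈ U, σ x ≤ R := fun x hx => by
    have := (le_abs_self _).trans (hS x (subset_closure hx))
    linarith [le_abs_self S, abs_nonneg T]
  have hτR : ∀ x ∈ U, τ x ≤ R := fun x hx => by
    have := (le_abs_self _).trans (hT x (subset_closure hx))
    linarith [le_abs_self T, abs_nonneg S]
  have hshell : ∀ {v : E × ℝ → ℝ}, Continuous v → ∀ {ε : ℝ}, 0 < ε →
      Continuous fun x => ∫ y in (ε * τ x)..(ε * σ x), v (x, y) / y ^ (n + 1) := by
    intro v hv ε hε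
    refine ((continuous_integral_div_pow hv (hτ.const_mul ε) (fun x => mul_pos hε (hτpos x))
      one_pos (n + 1)).sub (continuous_integral_div_pow hv (hσ.const_mul ε)
      (fun x => mul_pos hε (hσpos x)) one_pos (n + 1))).congr fun x => ?_
    exact integral_div_pow_sub (f := fun y => v (x, y)) (by fun_prop) (mul_pos hε (hτpos x))
      (mul_pos hε (hσpos x)) one_pos _
  have hcoef : ∀ j : ℕ, Continuous fun x => iteratedDeriv j (fun y => w (x, y)) 0 :=
    fun j => (contDiff_iteratedDeriv_snd hw j).continuous.comp (Continuous.prodMk_left 0)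
  have hterm : ∀ j : ℕ, Continuous fun x => iteratedDeriv j (fun y => w (x, y)) 0
      / (j.factorial : ℝ) * ∫ y in (τ x)..(σ x), y ^ j / y ^ (n + 1) := fun j =>
    ((hcoef j).div_const _).mul
      (by simpa using hshell (v := fun p => p.2 ^ j) (by fun_prop) one_pos)
  have hbound : ∀ᶠ ε : ℝ in 𝓝[>] (0 : ℝ), ‖(∫ x in U, (∫ y in (ε * τ x)..(ε * σ x),
        w (x, y) / y ^ (n + 1)) ∂μ)
      - ∑ j ∈ Finset.range (n + 1), (∫ x in U, iteratedDeriv j (fun y => w (x, y)) 0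
          / (j.factorial : ℝ) * (∫ y in (τ x)..(σ x), y ^ j / y ^ (n + 1)) ∂μ) * (ε ^ j / ε ^ n)‖
      ≤ M * (ε * R) * μ.real U := by
    filter_upwards [Ioo_mem_nhdsGT (show (0 : ℝ) < 1 / R by positivity)] with ε hε
    have hεR : ε * R < 1 := (lt_div_iff₀ hR0).1 hε.2
    simp_rw [← integral_mul_const]
    rw [← integral_finsetSum _ fun j _ =>
        ((hterm j).integrableOn_of_isBounded hU).mul_const _,
      ← integral_sub ((hshell hw.continuous hε.1).integrableOn_of_isBounded hU)
        (integrable_finsetSum _ fun j _ =>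
          ((hterm j).integrableOn_of_isBounded hU).mul_const _)]
    refine norm_setIntegral_le_of_norm_le_const
      ((measure_mono subset_closure).trans_lt hU.isCompact_closure.measure_lt_top) fun x hx => ?_
    have ha := mul_pos hε.1 (hτpos x)
    have hb := mul_pos hε.1 (hσpos x)
    have hwx : Continuous fun y => w (x, y) := hw.continuous.comp (by fun_prop)
    have haR : ε * τ x ≤ ε * R := mul_le_mul_of_nonneg_left (hτR x hx) hε.1.le
    have hbR : ε * σ x ≤ ε * R := mul_le_mul_of_nonneg_left (hσR x hx) hε.1.le
    have hsum : ∑ j ∈ Finset.range (n + 1), iteratedDeriv j (fun y => w (x, y)) 0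
          / (j.factorial : ℝ) * (∫ y in (τ x)..(σ x), y ^ j / y ^ (n + 1)) * (ε ^ j / ε ^ n)
        = ∫ y in (ε * τ x)..(ε * σ x), (∑ j ∈ Finset.range (n + 1),
          iteratedDeriv j (fun y => w (x, y)) 0 / (j.factorial : ℝ) * y ^ j) / y ^ (n + 1) := by
      simp_rw [Finset.sum_div, mul_div_assoc (_ / _) (_ ^ _) (_ ^ _)]
      rw [intervalIntegral.integral_finsetSum fun j _ =>
        (intervalIntegrable_div_pow (by fun_prop) ha hb _).const_mul _]
      refine Finset.sum_congr rfl fun j _ => ?_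
      rw [intervalIntegral.integral_const_mul, integral_pow_div_pow_smul j n hε.1]
      ring
    rw [hsum, ← intervalIntegral.integral_sub (intervalIntegrable_div_pow hwx ha hb _)
      (intervalIntegrable_div_pow (by fun_prop) ha hb _)]
    refine (intervalIntegral.norm_integral_le_of_norm_le_const (C := M) fun y hy => ?_).trans
      (mul_le_mul_of_nonneg_left (abs_le.2 ⟨by linarith, by linarith⟩) hM0)
    have hy0 : 0 < y := (lt_min ha hb).trans hy.1
    have hy1 : y ≤ 1 := hy.2.trans ((max_le haR hbR).trans hεR.le)
    rw [← sub_div, norm_div, Real.norm_eq_abs, Real.norm_of_nonneg (by positivity),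
      div_le_iff₀ (by positivity)]
    exact hM x hx y ⟨hy0.le, hy1⟩
  refine squeeze_zero_norm' hbound ?_
  have : Tendsto (fun ε : ℝ => M * (ε * R) * μ.real U) (𝓝 0) (𝓝 (M * (0 * R) * μ.real U)) :=
    Continuous.tendsto (by fun_prop) 0
  simpa using this.mono_left nhdsWithin_le_nhds

end

/-- Theorem 2.3 (transformation of the renormalized volume under change of regulator) in
the product-chart model: if the regulated volumes `F_τ` and `F_{e^ω τ}` admit small-`ε`
asymptotic expansions with constant terms `C` and `C'` respectively, then
`C' - C = -(1/(k-1)!) ∫_U ω(x) ∂_y^{k-1} w(x,0) dx`. -/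
theorem stmt5 (d : ℕ) (U : Set (EuclideanSpace ℝ (Fin (d-1)))) (hU : IsOpen U)
    (hUb : Bornology.IsBounded U) (L : ℝ) (hL : 0 < L)
    (w : EuclideanSpace ℝ (Fin (d-1)) × ℝ → ℝ) (hw : ContDiff ℝ (⊤ : ℕ∞) w)
    (k : ℕ) (hk : 1 ≤ k)
    (τ : EuclideanSpace ℝ (Fin (d-1)) → ℝ) (hτ : ContDiff ℝ (⊤ : ℕ∞) τ)
    (hτpos : ∀ x, 0 < τ x)
    (ω : EuclideanSpace ℝ (Fin (d-1)) → ℝ) (hω : ContDiff ℝ (⊤ : ℕ∞) ω)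
    (c c' : ℕ → ℝ) (A A' C C' : ℝ)
    (hexp : Filter.Tendsto (fun ε : ℝ =>
        (∫ x in U, ∫ y in (ε * τ x)..L, w (x, y) / y ^ k)
        - (∑ ℓ ∈ Finset.Icc 1 (k-1), c ℓ / ε ^ ℓ) - A * Real.log ε - C)
      (𝓝[>] (0:ℝ)) (𝓝 0))
    (hexp' : Filter.Tendsto (fun ε : ℝ =>
        (∫ x in U, ∫ y in (ε * (Real.exp (ω x) * τ x))..L, w (x, y) / y ^ k)
        - (∑ ℓ ∈ Finset.Icc 1 (k-1), c' ℓ / ε ^ ℓ) - A' * Real.log ε - C')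
      (𝓝[>] (0:ℝ)) (𝓝 0)) :
    C' - C = -(1 / ((k-1).factorial : ℝ))
      * ∫ x in U, ω x * iteratedDeriv (k-1) (fun y => w (x, y)) 0 := by
  obtain ⟨n, rfl⟩ : ∃ n, k = n + 1 := ⟨k - 1, by omega⟩
  simp only [Nat.add_sub_cancel] at hexp hexp' ⊢
  have hσpos : ∀ x, 0 < Real.exp (ω x) * τ x := fun x => mul_pos (Real.exp_pos _) (hτpos x)
  have hσ : Continuous fun x => Real.exp (ω x) * τ x :=
    (Real.continuous_exp.comp hω.continuous).mul hτ.continuous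
  have hshell := tendsto_integral_shell_sub_sum (μ := volume) hw hUb
    hτ.continuous hσ hτpos hσpos n
  set β : ℕ → ℝ := fun j => ∫ x in U, iteratedDeriv j (fun y => w (x, y)) 0 / (j.factorial : ℝ)
    * ∫ y in (τ x)..(Real.exp (ω x) * τ x), y ^ j / y ^ (n + 1) with hβ
  have hβn : β n = 1 / (n.factorial : ℝ)
      * ∫ x in U, ω x * iteratedDeriv n (fun y => w (x, y)) 0 := by
    rw [hβ, ← integral_const_mul]
    refine integral_congr_ae (Eventually.of_forall fun x => ?_)
    have hlog : ∫ y in (τ x)..(Real.exp (ω x) * τ x), y ^ n / y ^ (n + 1) = ω x := by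
      have h1 : ∫ y in (τ x)..(Real.exp (ω x) * τ x), y ^ n / y ^ (n + 1)
          = ∫ y in (τ x)..(Real.exp (ω x) * τ x), y⁻¹ := by
        refine intervalIntegral.integral_congr fun y hy => ?_
        have : y ≠ 0 := ((lt_min (hτpos x) (hσpos x)).trans_le hy.1).ne'
        field_simp
        ring
      rw [h1, integral_inv_of_pos (hτpos x) (hσpos x), mul_div_assoc, div_self (hτpos x).ne',
        mul_one, Real.log_exp]
    simp only [hlog]
    ring
  have hzero : C' - C + β n = 0 := by
    refine constant_eq_zero_of_tendsto_zero n (fun ℓ => c' ℓ - c ℓ + β (n - ℓ)) (A' - A) _ ?_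
    have h := (hexp.sub hexp').sub hshell
    simp only [sub_zero] at h
    refine h.congr' ?_
    filter_upwards [self_mem_nhdsWithin] with ε hε
    have hε : 0 < ε := hε
    have hF : (∫ x in U, ∫ y in (ε * τ x)..L, w (x, y) / y ^ (n + 1))
        - (∫ x in U, ∫ y in (ε * (Real.exp (ω x) * τ x))..L, w (x, y) / y ^ (n + 1))
        = ∫ x in U, ∫ y in (ε * τ x)..(ε * (Real.exp (ω x) * τ x)), w (x, y) / y ^ (n + 1) := by
      rw [← integral_sub]
      · refine integral_congr_ae (Eventually.of_forall fun x => ?_)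
        exact integral_div_pow_sub (f := fun y => w (x, y)) (hw.continuous.comp (by fun_prop))
          (mul_pos hε (hτpos x)) (mul_pos hε (hσpos x)) hL _
      · exact (continuous_integral_div_pow hw.continuous (hτ.continuous.const_mul ε)
          (fun x => mul_pos hε (hτpos x)) hL _).integrableOn_of_isBounded hUb
      · exact (continuous_integral_div_pow hw.continuous (hσ.const_mul ε)
          (fun x => mul_pos hε (hσpos x)) hL _).integrableOn_of_isBounded hUb
    have hsum : ∑ j ∈ Finset.range (n + 1), β j * (ε ^ j / ε ^ n)
        = (∑ ℓ ∈ Finset.Icc 1 n, β (n - ℓ) / ε ^ ℓ) + β n := by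
      rw [Finset.sum_range_succ, div_self (by positivity), mul_one]
      congr 1
      refine Finset.sum_nbij' (fun j => n - j) (fun ℓ => n - ℓ) ?_ ?_ ?_ ?_ fun j hj => ?_
      · simp only [Finset.mem_range, Finset.mem_Icc]; omega
      · simp only [Finset.mem_range, Finset.mem_Icc]; omega
      · simp only [Finset.mem_range]; omega
      · simp only [Finset.mem_Icc]; omega
      · have hjn : j ≤ n := (Finset.mem_range.1 hj).le
        rw [Nat.sub_sub_self hjn, pow_sub₀ _ hε.ne' hjn]
        field_simp
    rw [← hF, hsum]
    simp only [add_div, sub_div, Finset.sum_add_distrib, Finset.sum_sub_distrib]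
    ring
  linarith
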